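/- Degree width of the renormalised Bethe vector: for every N ≥ 1 and each σ ∈ {⇑,0,⇓}^N, the component function (w₁,…,w_N) ↦ ⟨σ|Ψ̃(w₁,…,w_N)⟩ agrees on its domain of definition with a unique Laurent polynomial Ψ̃_σ ∈ ℂ[w₁^{±1},…,w_N^{±1}], and for every j = 1,…,N all exponents of w_j occurring in Ψ̃_σ lie in the interval [−(N−1), N−1]; moreover, for every j the maximal degree width 2(N−1) in w_j is attained by some component σ. -/

import Mathlib

open Matrix BigOperators Finset

noncomputable section

/-- `[z] = z - z⁻¹`. -/
def br (z : ℂ) : ℂ := z - z⁻¹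

/-- R-matrix `R^{(1,2)}(z)` on ℂ²⊗ℂ³; basis `(ε, σ)` with ε ∈ {0=↑,1=↓}, σ ∈ {0=⇑,1=0,2=⇓}. -/
def R12 (q c z : ℂ) : Matrix (Fin 2 × Fin 3) (Fin 2 × Fin 3) ℂ :=
  Matrix.of fun p p' =>
    if p = (0,0) ∧ p' = (0,0) then br (q^2*z)
    else if p = (0,1) ∧ p' = (0,1) then br (q*z)
    else if p = (0,2) ∧ p' = (0,2) then br z
    else if p = (1,0) ∧ p' = (1,0) then br z
    else if p = (1,1) ∧ p' = (1,1) then br (q*z)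
    else if p = (1,2) ∧ p' = (1,2) then br (q^2*z)
    else if p = (0,1) ∧ p' = (1,0) then c
    else if p = (0,2) ∧ p' = (1,1) then c
    else if p = (1,0) ∧ p' = (0,1) then c
    else if p = (1,1) ∧ p' = (0,2) then c
    else 0

/-- `R^{(1,2)}` acting on the auxiliary ℂ² and the j-th site of `(ℂ³)^{⊗N}`. -/
def R12at (q c z : ℂ) {N : ℕ} (j : Fin N) :
    Matrix (Fin 2 × (Fin N → Fin 3)) (Fin 2 × (Fin N → Fin 3)) ℂ :=
  Matrix.of fun p p' =>
    R12 q c z (p.1, p.2 j) (p'.1, p'.2 j) *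
      if ∀ k, k ≠ j → p.2 k = p'.2 k then 1 else 0

/-- Monodromy matrix `𝒯_a(z) = R^{(1,2)}_{a,N}(q⁻¹z/w_N) ⋯ R^{(1,2)}_{a,1}(q⁻¹z/w₁)`. -/
def monodromy (q c : ℂ) {N : ℕ} (w : Fin N → ℂ) (z : ℂ) :
    Matrix (Fin 2 × (Fin N → Fin 3)) (Fin 2 × (Fin N → Fin 3)) ℂ :=
  (((List.finRange N).reverse).map fun j => R12at q c (q⁻¹ * z / w j) j).prod

/-- The operator 𝒜(z): auxiliary block (↑,↑) of the monodromy matrix. -/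
def Aop (q c : ℂ) {N : ℕ} (w : Fin N → ℂ) (z : ℂ) :
    Matrix (Fin N → Fin 3) (Fin N → Fin 3) ℂ :=
  Matrix.of fun σ τ => monodromy q c w z (0, σ) (0, τ)

/-- The operator ℬ(z): auxiliary block (↑,↓) of the monodromy matrix. -/
def Bop (q c : ℂ) {N : ℕ} (w : Fin N → ℂ) (z : ℂ) :
    Matrix (Fin N → Fin 3) (Fin N → Fin 3) ℂ :=
  Matrix.of fun σ τ => monodromy q c w z (0, σ) (1, τ)

/-- The operator 𝒟(z): auxiliary block (↓,↓) of the monodromy matrix. -/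
def Dop (q c : ℂ) {N : ℕ} (w : Fin N → ℂ) (z : ℂ) :
    Matrix (Fin N → Fin 3) (Fin N → Fin 3) ℂ :=
  Matrix.of fun σ τ => monodromy q c w z (1, σ) (1, τ)

/-- Bethe reference state `|∧⟩ = |⇑…⇑⟩`. -/
def vac (N : ℕ) : (Fin N → Fin 3) → ℂ := fun σ => if σ = fun _ => 0 then 1 else 0

/-- Bethe vector `|Ψ(w₁,…,w_N)⟩ = ℬ(w₁)⋯ℬ(w_N)|∧⟩`. -/
def bethe (q c : ℂ) {N : ℕ} (w : Fin N → ℂ) : (Fin N → Fin 3) → ℂ :=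
  (((List.finRange N).map fun j => Bop q c w (w j)).prod).mulVec (vac N)

/-- Renormalised Bethe vector
`|Ψ̃(w₁,…,w_N)⟩ = c^{−N} (∏_{j<k} [q w_j/w_k])⁻¹ |Ψ(w₁,…,w_N)⟩`. -/
def betheTilde (q c : ℂ) {N : ℕ} (w : Fin N → ℂ) : (Fin N → Fin 3) → ℂ :=
  ((c ^ N)⁻¹ *
    (∏ pr ∈ Finset.univ.filter (fun pr : Fin N × Fin N => pr.1 < pr.2),
      br (q * w pr.1 / w pr.2))⁻¹) • bethe q c w

/-- Genericity domain: nonzero inhomogeneities with all normalisation brackets nonzero. -/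
def goodW (q : ℂ) {N : ℕ} (w : Fin N → ℂ) : Prop :=
  (∀ j, w j ≠ 0) ∧ ∀ j k : Fin N, j < k → q * w j / w k ≠ 1 ∧ q * w j / w k ≠ -1

/-- The Lax matrix `x y R^{(1,2)}(q⁻¹ x / y)`, as a matrix on the auxiliary space for each pair of
outgoing and incoming spin-one states. -/
def lax (q c x y : ℂ) (s t : Fin 3) : Matrix (Fin 2) (Fin 2) ℂ :=
  (![![!![q * x^2 - q⁻¹ * y^2, 0; 0, q⁻¹ * x^2 - q * y^2], !![0, 0; c * (x * y), 0], 0],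
     ![!![0, c * (x * y); 0, 0], !![x^2 - y^2, 0; 0, x^2 - y^2], !![0, 0; c * (x * y), 0]],
     ![0, !![0, c * (x * y); 0, 0], !![q⁻¹ * x^2 - q * y^2, 0; 0, q * x^2 - q⁻¹ * y^2]]] :
    Fin 3 → Fin 3 → Matrix (Fin 2) (Fin 2) ℂ) s t

/-- The six-vertex R-matrix on two auxiliary spaces, scaled by `u v`. -/
def sixVertex (q u v : ℂ) : Matrix (Fin 2 × Fin 2) (Fin 2 × Fin 2) ℂ :=
  Matrix.of fun p p' =>
    if p = p' then (if p.1 = p.2 then q * u^2 - q⁻¹ * v^2 else u^2 - v^2)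
    else if p.1 = p'.2 ∧ p.2 = p'.1 then (q - q⁻¹) * (u * v)
    else 0

set_option maxHeartbeats 8000000 in
open scoped Kronecker in
theorem sixVertex_yangBaxter {q c : ℂ} (hq : q ≠ 0) (hc : c^2 = br q * br (q^2)) (u v y : ℂ)
    (s t : Fin 3) :
    sixVertex q u v * (∑ r, lax q c u y s r ⊗ₖ lax q c v y r t) =
      (∑ r, lax q c u y r t ⊗ₖ lax q c v y s r) * sixVertex q u v := by
  have hp : q * q⁻¹ = 1 := mul_inv_cancel₀ hq
  rw [br, br, ← inv_pow] at hc
  unfold sixVertex lax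
  generalize q⁻¹ = p at *
  ext ⟨a, b⟩ ⟨a', b'⟩
  fin_cases s <;> fin_cases t <;> fin_cases a <;> fin_cases b <;> fin_cases a' <;> fin_cases b' <;>
  simp [Matrix.mul_apply, Fintype.sum_prod_type, Fin.sum_univ_succ, Matrix.add_apply] <;>
  grind

/-- The `(↑, ↓)` auxiliary block of a product of local operators over the sites, the last site
acting last. -/
def rowOp {N : ℕ} (L : Fin N → Fin 3 → Fin 3 → Matrix (Fin 2) (Fin 2) ℂ) :
    Matrix (Fin N → Fin 3) (Fin N → Fin 3) ℂ :=
  Matrix.of fun σ τ => (((List.finRange N).reverse.map fun j => L j (σ j) (τ j)).prod) 0 1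

theorem sum_prod_reverse_finRange {R ι : Type*} [Semiring R] [Fintype ι] [DecidableEq ι] {N : ℕ}
    (F : Fin N → ι → R) :
    ∑ ρ : Fin N → ι, (((List.finRange N).reverse.map fun j => F j (ρ j)).prod) =
      ((List.finRange N).reverse.map fun j => ∑ r, F j r).prod := by
  induction N with
  | zero => simp
  | succ n ih =>
    rw [← (Fin.consEquiv fun _ => ι).sum_comp, Fintype.sum_prod_type]
    simp only [List.finRange_succ, List.reverse_cons, List.map_append, List.map_cons, List.map_nil,
      List.prod_append, List.prod_cons, List.prod_nil, mul_one, ← List.map_reverse, List.map_map,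
      Function.comp_def, Fin.consEquiv_apply, Fin.cons_succ, Fin.cons_zero]
    rw [← ih, Finset.sum_comm, Finset.sum_mul]
    exact Finset.sum_congr rfl fun ρ _ => (Finset.mul_sum _ _ _).symm

open scoped Kronecker in
theorem kronecker_list_prod {α : Type*} (l : List α) {m n : Type*} [Fintype m] [DecidableEq m]
    [Fintype n] [DecidableEq n] (F : α → Matrix m m ℂ) (G : α → Matrix n n ℂ) :
    (l.map F).prod ⊗ₖ (l.map G).prod = (l.map fun j => F j ⊗ₖ G j).prod := by
  induction l with
  | nil => simp
  | cons a l ih => simp only [List.map_cons, List.prod_cons, Matrix.mul_kronecker_mul, ih]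

open scoped Kronecker in
theorem sum_list_prod_apply_mul {N : ℕ} (F G : Fin N → Fin 3 → Matrix (Fin 2) (Fin 2) ℂ)
    (a b a' b' : Fin 2) :
    ∑ ρ : Fin N → Fin 3, (((List.finRange N).reverse.map fun j => F j (ρ j)).prod) a a' *
        (((List.finRange N).reverse.map fun j => G j (ρ j)).prod) b b' =
      (((List.finRange N).reverse.map fun j => ∑ r, F j r ⊗ₖ G j r).prod) (a, b) (a', b') := by
  rw [← sum_prod_reverse_finRange, Matrix.sum_apply]
  refine Finset.sum_congr rfl fun ρ _ => ?_
  rw [← kronecker_list_prod, Matrix.kroneckerMap_apply]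

theorem semiconj_list_prod {α R : Type*} [Monoid R] (x : R) (F G : α → R) (l : List α)
    (h : ∀ a ∈ l, x * F a = G a * x) : x * (l.map F).prod = (l.map G).prod * x := by
  induction l with
  | nil => simp
  | cons a l ih =>
    simp only [List.map_cons, List.prod_cons]
    rw [← mul_assoc, h a (by simp), mul_assoc, ih fun b hb => h b (by simp [hb]), mul_assoc]

theorem sixVertex_mul_apply_corner (q u v : ℂ) (X : Matrix (Fin 2 × Fin 2) (Fin 2 × Fin 2) ℂ) :
    (sixVertex q u v * X) (0, 0) (1, 1) = (q * u^2 - q⁻¹ * v^2) * X (0, 0) (1, 1) := by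
  simp [sixVertex, Matrix.mul_apply, Fintype.sum_prod_type]

theorem mul_sixVertex_apply_corner (q u v : ℂ) (X : Matrix (Fin 2 × Fin 2) (Fin 2 × Fin 2) ℂ) :
    (X * sixVertex q u v) (0, 0) (1, 1) = (q * u^2 - q⁻¹ * v^2) * X (0, 0) (1, 1) := by
  simp [sixVertex, Matrix.mul_apply, Fintype.sum_prod_type, mul_comm]

open scoped Kronecker in
theorem rowOp_mul_apply {N : ℕ} (L L' : Fin N → Fin 3 → Fin 3 → Matrix (Fin 2) (Fin 2) ℂ)
    (σ τ : Fin N → Fin 3) :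
    (rowOp L * rowOp L') σ τ = (((List.finRange N).reverse.map fun j =>
      ∑ r, L j (σ j) r ⊗ₖ L' j r (τ j)).prod) (0, 0) (1, 1) := by
  rw [← sum_list_prod_apply_mul, Matrix.mul_apply]
  rfl

open scoped Kronecker in
theorem rowOp_mul_apply' {N : ℕ} (L L' : Fin N → Fin 3 → Fin 3 → Matrix (Fin 2) (Fin 2) ℂ)
    (σ τ : Fin N → Fin 3) :
    (rowOp L' * rowOp L) σ τ = (((List.finRange N).reverse.map fun j =>
      ∑ r, L j r (τ j) ⊗ₖ L' j (σ j) r).prod) (0, 0) (1, 1) := by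
  rw [← sum_list_prod_apply_mul, Matrix.mul_apply]
  exact Finset.sum_congr rfl fun ρ _ => mul_comm _ _

theorem rowOp_lax_commute_of_ne {q c : ℂ} (hq : q ≠ 0) (hc : c^2 = br q * br (q^2)) {N : ℕ}
    (y : Fin N → ℂ) (u v : ℂ) (h : q * u^2 - q⁻¹ * v^2 ≠ 0) :
    Commute (rowOp fun j => lax q c u (y j)) (rowOp fun j => lax q c v (y j)) := by
  ext σ τ
  refine mul_left_cancel₀ h ?_
  rw [rowOp_mul_apply, rowOp_mul_apply', ← sixVertex_mul_apply_corner,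
    ← mul_sixVertex_apply_corner]
  refine congrArg (fun X : Matrix (Fin 2 × Fin 2) (Fin 2 × Fin 2) ℂ => X (0, 0) (1, 1)) ?_
  exact semiconj_list_prod _ _ _ _ fun j _ => sixVertex_yangBaxter hq hc u v (y j) (σ j) (τ j)

theorem rowOp_lax_commute {q c : ℂ} (hq : q ≠ 0) (hq4 : q^4 ≠ 1) (hc : c^2 = br q * br (q^2))
    {N : ℕ} (y : Fin N → ℂ) (u v : ℂ) (hu : u ≠ 0) :
    Commute (rowOp fun j => lax q c u (y j)) (rowOp fun j => lax q c v (y j)) := by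
  by_cases h : q * u^2 - q⁻¹ * v^2 = 0
  · refine (rowOp_lax_commute_of_ne hq hc y v u fun h' => hq4 ?_).symm
    field_simp at h h'
    have : (q^4 - 1) * u^2 = 0 := by linear_combination q^2 * h + h'
    rcases mul_eq_zero.1 this with h0 | h0
    · linear_combination h0
    · exact absurd h0 (pow_ne_zero 2 hu)
  · exact rowOp_lax_commute_of_ne hq hc y u v h

open scoped Kronecker in
/-- The two-row transfer operator across one site whose incoming state is `⇑`. -/
def column (q c u v y : ℂ) (s : Fin 3) : Matrix (Fin 2 × Fin 2) (Fin 2 × Fin 2) ℂ :=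
  ∑ r, lax q c u y s r ⊗ₖ lax q c v y r 0

theorem column_mulVec_fused {q c u v y : ℂ} (hq : q ≠ 0) (hc : c^2 = br q * br (q^2))
    (h : v^2 = q^2 * u^2) (s : Fin 3) (x : Fin 2 × Fin 2 → ℂ) (hx : v * x (0, 1) = q * u * x (1, 0)) :
    v * (column q c u v y s *ᵥ x) (0, 1) = q * u * (column q c u v y s *ᵥ x) (1, 0) := by
  have hp : q * q⁻¹ = 1 := mul_inv_cancel₀ hq
  rw [br, br, ← inv_pow] at hc
  unfold column lax
  generalize q⁻¹ = p at *
  fin_cases s <;>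
  simp [Matrix.mulVec, dotProduct, Fintype.sum_prod_type, Fin.sum_univ_succ, Matrix.add_apply] <;>
  grind

theorem column_mulVec_fused_self {q c u v : ℂ} (hq : q ≠ 0) (hc : c^2 = br q * br (q^2))
    (hu : u ≠ 0) (h : v^2 = q^2 * u^2) (s : Fin 3) (x : Fin 2 × Fin 2 → ℂ)
    (hx : v * x (0, 1) = q * u * x (1, 0)) {e : Fin 2 × Fin 2} (he : e ≠ (0, 0)) :
    (column q c u v u s *ᵥ x) e = 0 := by
  have hqq : q * q⁻¹ = 1 := mul_inv_cancel₀ hq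
  rw [br, br, ← inv_pow] at hc
  unfold column lax
  generalize q⁻¹ = p at *
  obtain ⟨a, b⟩ := e
  fin_cases s <;> fin_cases a <;> fin_cases b <;> simp at he <;>
  simp [Matrix.mulVec, dotProduct, Fintype.sum_prod_type, Fin.sum_univ_succ, Matrix.add_apply] <;>
  grind

theorem column_mulVec_up (q c u v y : ℂ) (s : Fin 3) (x : Fin 2 × Fin 2 → ℂ)
    (hx : ∀ p ≠ (0, 0), x p = 0) {p : Fin 2 × Fin 2} (hp : p ≠ (0, 0)) :
    (column q c u v y s *ᵥ x) p = 0 := by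
  have h1 := hx (0, 1) (by simp)
  have h2 := hx (1, 0) (by simp)
  have h3 := hx (1, 1) (by simp)
  unfold column lax
  obtain ⟨a, b⟩ := p
  fin_cases s <;> fin_cases a <;> fin_cases b <;> simp at hp <;>
  simp [Matrix.mulVec, dotProduct, Fintype.sum_prod_type, Fin.sum_univ_succ, Matrix.add_apply, *]

theorem column_mulVec_up_self {q c u v : ℂ} (hq : q ≠ 0) (h : v^2 = q^2 * u^2) (s : Fin 3)
    (x : Fin 2 × Fin 2 → ℂ) (hx : ∀ p ≠ (0, 0), x p = 0) :
    (column q c u v v s *ᵥ x) (0, 0) = 0 := by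
  have hqq : q * q⁻¹ = 1 := mul_inv_cancel₀ hq
  have h1 := hx (0, 1) (by simp)
  have h2 := hx (1, 0) (by simp)
  have h3 := hx (1, 1) (by simp)
  unfold column lax
  generalize q⁻¹ = p at *
  fin_cases s <;>
  simp [Matrix.mulVec, dotProduct, Fintype.sum_prod_type, Fin.sum_univ_succ, Matrix.add_apply, h1,
    h2, h3] <;>
  grind

theorem list_prod_mulVec_induction {α n : Type*} [Fintype n] [DecidableEq n] (l : List α)
    (F : α → Matrix n n ℂ) (P : (n → ℂ) → Prop) (hF : ∀ a x, P x → P (F a *ᵥ x)) (x : n → ℂ)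
    (hx : P x) : P ((l.map F).prod *ᵥ x) := by
  induction l with
  | nil => simpa
  | cons a l ih =>
    rw [List.map_cons, List.prod_cons, ← Matrix.mulVec_mulVec]
    exact hF _ _ ih

theorem exists_finRange_split {N : ℕ} {j k : Fin N} (h : j < k) :
    ∃ l₁ l₂ l₃, List.finRange N = l₁ ++ j :: (l₂ ++ k :: l₃) := by
  obtain ⟨l₁, l, hl⟩ := List.append_of_mem (List.mem_finRange j)
  have hs : (List.finRange N).Pairwise (· < ·) := List.pairwise_lt_finRange N
  have hk : k ∈ List.finRange N := List.mem_finRange k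
  rw [hl] at hs hk
  rw [List.pairwise_append] at hs
  have hk' : k ∈ l := by
    rcases List.mem_append.1 hk with h1 | h1
    · exact absurd (hs.2.2 k h1 j (by simp)) (not_lt.2 h.le)
    · rcases List.mem_cons.1 h1 with h2 | h2
      · exact absurd h2 h.ne'
      · exact h2
  obtain ⟨l₂, l₃, rfl⟩ := List.append_of_mem hk'
  exact ⟨l₁, l₂, l₃, hl⟩

/-- Two rows whose parameters are the fusion-related inhomogeneities of two sites annihilate the
reference state. -/
theorem rowOp_lax_mul_apply_vac_eq_zero {q c : ℂ} (hq : q ≠ 0) (hc : c^2 = br q * br (q^2))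
    {N : ℕ} (w : Fin N → ℂ) {j k : Fin N} (hjk : j < k) (hw : w j ≠ 0)
    (h : w k ^ 2 = q^2 * w j ^ 2) (σ : Fin N → Fin 3) :
    ((rowOp fun i => lax q c (w j) (w i)) * (rowOp fun i => lax q c (w k) (w i))) σ 0 = 0 := by
  rw [rowOp_mul_apply]
  obtain ⟨l₁, l₂, l₃, hl⟩ := exists_finRange_split hjk
  set F : Fin N → Matrix (Fin 2 × Fin 2) (Fin 2 × Fin 2) ℂ :=
    fun i => column q c (w j) (w k) (w i) (σ i) with hF
  have key : ∀ X : Matrix (Fin 2 × Fin 2) (Fin 2 × Fin 2) ℂ,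
      X (0, 0) (1, 1) = (X *ᵥ Pi.single (1, 1) 1) (0, 0) := by simp
  refine (key ((List.finRange N).reverse.map F).prod).trans ?_
  rw [hl]
  simp only [List.reverse_append, List.reverse_cons, List.map_append, List.map_cons, List.map_nil,
    List.prod_append, List.prod_cons, List.prod_nil, mul_one, ← Matrix.mulVec_mulVec]
  have h1 := list_prod_mulVec_induction l₁.reverse F
    (fun x => w k * x (0, 1) = q * w j * x (1, 0))
    (fun i x hx => column_mulVec_fused hq hc h (σ i) x hx) (Pi.single (1, 1) 1) (by simp)
  have h2 : ∀ p ≠ (0, 0), (F j *ᵥ ((l₁.reverse.map F).prod *ᵥ Pi.single (1, 1) 1)) p = 0 :=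
    fun p hp => column_mulVec_fused_self hq hc hw h (σ j) _ h1 hp
  have h3 := list_prod_mulVec_induction l₂.reverse F (fun x => ∀ p ≠ (0, 0), x p = 0)
    (fun i x hx p hp => column_mulVec_up q c _ _ _ (σ i) x hx hp) _ h2
  have h4 : F k *ᵥ ((l₂.reverse.map F).prod *ᵥ
      (F j *ᵥ ((l₁.reverse.map F).prod *ᵥ Pi.single (1, 1) 1))) = 0 := by
    ext p
    by_cases hp : p = (0, 0)
    · rw [hp]
      exact column_mulVec_up_self hq h (σ k) _ h3
    · exact column_mulVec_up q c _ _ _ (σ k) _ h3 hp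
  rw [h4, Matrix.mulVec_zero]
  rfl

/-- Rows of local operators, one for each site, applied successively to the reference state. -/
def betheOf {N : ℕ} (L : Fin N → Fin N → Fin 3 → Fin 3 → Matrix (Fin 2) (Fin 2) ℂ) :
    (Fin N → Fin 3) → ℂ :=
  ((List.finRange N).map fun i => rowOp (L i)).prod *ᵥ vac N

/-- The denominator-free local operators of the Bethe vector. -/
def hatLax (q c : ℂ) {N : ℕ} (w : Fin N → ℂ) (i j : Fin N) :
    Fin 3 → Fin 3 → Matrix (Fin 2) (Fin 2) ℂ :=
  if i = j then lax q c 1 1 else lax q c (w i) (w j)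

/-- The Bethe vector with all denominators cleared. -/
def betheHat (q c : ℂ) {N : ℕ} (w : Fin N → ℂ) : (Fin N → Fin 3) → ℂ :=
  betheOf (hatLax q c w)

theorem list_prod_map_smul {α R : Type*} [Semiring R] [Algebra ℂ R] (l : List α) (a : α → ℂ)
    (F : α → R) : (l.map fun j => a j • F j).prod = (l.map a).prod • (l.map F).prod := by
  induction l with
  | nil => simp
  | cons x l ih => simp only [List.map_cons, List.prod_cons, ih, smul_mul_smul_comm]

theorem rowOp_smul {N : ℕ} (a : Fin N → ℂ) (L : Fin N → Fin 3 → Fin 3 → Matrix (Fin 2) (Fin 2) ℂ) :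
    rowOp (fun j s t => a j • L j s t) = (∏ j, a j) • rowOp L := by
  ext σ τ
  rw [Fin.prod_univ_def, ← ((List.reverse_perm (List.finRange N)).map a).prod_eq]
  simp only [rowOp, Matrix.of_apply, Matrix.smul_apply]
  rw [list_prod_map_smul, Matrix.smul_apply]

theorem betheOf_smul {N : ℕ} (a : Fin N → Fin N → ℂ)
    (L : Fin N → Fin N → Fin 3 → Fin 3 → Matrix (Fin 2) (Fin 2) ℂ) :
    betheOf (fun i j s t => a i j • L i j s t) = (∏ i, ∏ j, a i j) • betheOf L := by
  simp only [betheOf, rowOp_smul]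
  rw [list_prod_map_smul, Matrix.smul_mulVec, Fin.prod_univ_def]

theorem R12at_list_prod_apply (q c : ℂ) {N : ℕ} (z : Fin N → ℂ) (l : List (Fin N)) (hl : l.Nodup)
    (a b : Fin 2) (σ τ : Fin N → Fin 3) :
    (l.map fun j => R12at q c (z j) j).prod (a, σ) (b, τ) =
      if ∀ k, k ∉ l → σ k = τ k then
        (l.map fun j => (Matrix.of fun a b => R12 q c (z j) (a, σ j) (b, τ j) :
          Matrix (Fin 2) (Fin 2) ℂ)).prod a b else 0 := by
  induction l generalizing a σ with
  | nil =>
    by_cases h : σ = τ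
    · subst h
      simp [Matrix.one_apply]
    · have h' : ¬ ∀ k, σ k = τ k := fun h' => h (funext h')
      simp [h, h']
  | cons j l ih =>
    obtain ⟨hj, hl⟩ := List.nodup_cons.1 hl
    rw [List.map_cons, List.prod_cons, Matrix.mul_apply, Fintype.sum_prod_type]
    have h1 : ∀ e, ∑ ρ, R12at q c (z j) j (a, σ) (e, ρ) *
        (l.map fun j => R12at q c (z j) j).prod (e, ρ) (b, τ) =
        R12at q c (z j) j (a, σ) (e, Function.update σ j (τ j)) *
        (l.map fun j => R12at q c (z j) j).prod (e, Function.update σ j (τ j)) (b, τ) := by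
      intro e
      refine Finset.sum_eq_single _ (fun ρ _ hρ => ?_) (by simp)
      rw [ih hl]
      by_cases h2 : ∀ k, k ≠ j → σ k = ρ k
      · rw [if_neg, mul_zero]
        intro h3
        refine hρ (funext fun k => ?_)
        by_cases hk : k = j
        · subst hk
          simp [h3 k hj]
        · simp [hk, h2 k hk]
      · simp [R12at, h2]
    have h2 : (l.map fun i => (Matrix.of fun a b => R12 q c (z i)
        (a, Function.update σ j (τ j) i) (b, τ i) : Matrix (Fin 2) (Fin 2) ℂ)) =
        l.map fun i => (Matrix.of fun a b => R12 q c (z i) (a, σ i) (b, τ i) :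
          Matrix (Fin 2) (Fin 2) ℂ) := by
      refine List.map_congr_left fun i hi => ?_
      rw [Function.update_of_ne]
      rintro rfl
      exact hj hi
    have h3 : (∀ k, k ∉ l → Function.update σ j (τ j) k = τ k) ↔
        ∀ k, k ∉ j :: l → σ k = τ k := by
      refine forall_congr' fun k => ?_
      by_cases hk : k = j
      · subst hk
        simp
      · simp [hk]
    rw [Finset.sum_congr rfl fun e _ => h1 e]
    simp only [ih hl, h2, h3]
    have h4 : ∀ k, k ≠ j → σ k = Function.update σ j (τ j) k := fun k hk => by simp [hk]
    split_ifs with h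
    · rw [List.map_cons, List.prod_cons, Matrix.mul_apply]
      refine Finset.sum_congr rfl fun e _ => ?_
      rw [R12at, Matrix.of_apply, if_pos h4]
      simp
    · simp

theorem bethe_eq_betheOf (q c : ℂ) {N : ℕ} (w : Fin N → ℂ) :
    bethe q c w = betheOf fun i j s t =>
      Matrix.of fun a b => R12 q c (q⁻¹ * w i / w j) (a, s) (b, t) := by
  have h : ∀ i, Bop q c w (w i) = rowOp fun j s t =>
      Matrix.of fun a b => R12 q c (q⁻¹ * w i / w j) (a, s) (b, t) := by
    intro i
    ext σ τ
    simp only [Bop, rowOp, Matrix.of_apply, monodromy]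
    rw [R12at_list_prod_apply q c _ _ (List.nodup_reverse.2 (List.nodup_finRange N)), if_pos]
    simp
  simp only [bethe, betheOf, h]

theorem R12_eq_lax {q : ℂ} (c : ℂ) (hq : q ≠ 0) {x y : ℂ} (hx : x ≠ 0) (hy : y ≠ 0) (s t : Fin 3) :
    (Matrix.of fun a b => R12 q c (q⁻¹ * x / y) (a, s) (b, t) : Matrix (Fin 2) (Fin 2) ℂ) =
      (x * y)⁻¹ • lax q c x y s t := by
  ext a b
  fin_cases s <;> fin_cases t <;> fin_cases a <;> fin_cases b <;>
  simp [R12, lax, br] <;> field_simp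

theorem R12_eq_hatLax {q : ℂ} (c : ℂ) (hq : q ≠ 0) {N : ℕ} (w : Fin N → ℂ) (hw : ∀ j, w j ≠ 0)
    (i j : Fin N) (s t : Fin 3) :
    (Matrix.of fun a b => R12 q c (q⁻¹ * w i / w j) (a, s) (b, t) : Matrix (Fin 2) (Fin 2) ℂ) =
      (if i = j then 1 else w i * w j)⁻¹ • hatLax q c w i j s t := by
  unfold hatLax
  split_ifs with h
  · subst h
    rw [mul_div_assoc, div_self (hw i), ← div_one (1 : ℂ), ← mul_div_assoc,
      R12_eq_lax c hq one_ne_zero one_ne_zero]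
    simp
  · exact R12_eq_lax c hq (hw i) (hw j) s t

@[to_additive]
theorem prod_prod_ite_eq {M : Type*} [CommMonoid M] {N : ℕ} (f : Fin N → M) :
    ∏ i, ∏ j, (if i = j then 1 else f i) = ∏ i, f i ^ (N - 1) := by
  refine Finset.prod_congr rfl fun i _ => ?_
  rw [Finset.prod_ite, Finset.prod_const_one, one_mul, Finset.prod_const, Finset.filter_not,
    Finset.filter_eq, if_pos (Finset.mem_univ i), Finset.card_sdiff_of_subset (by simp)]
  simp

@[to_additive]
theorem prod_prod_ite_eq_mul {M : Type*} [CommMonoid M] {N : ℕ} (f : Fin N → M) :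
    ∏ i, ∏ j, (if i = j then 1 else f i * f j) = ∏ i, f i ^ (2 * (N - 1)) := by
  have h : ∀ i j : Fin N, (if i = j then 1 else f i * f j) =
      (if i = j then 1 else f i) * (if j = i then 1 else f j) := by
    intro i j
    by_cases h : i = j
    · simp [h]
    · simp [h, Ne.symm h]
  simp only [h, Finset.prod_mul_distrib]
  rw [Finset.prod_comm (f := fun i j => if j = i then 1 else f j), prod_prod_ite_eq,
    ← Finset.prod_mul_distrib]
  simp only [two_mul, pow_add]

@[to_additive]
theorem prod_lt_mul {M : Type*} [CommMonoid M] {N : ℕ} (f : Fin N → M) :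
    ∏ pr ∈ Finset.univ.filter (fun pr : Fin N × Fin N => pr.1 < pr.2), (f pr.1 * f pr.2) =
      ∏ i, f i ^ (N - 1) := by
  rw [Finset.prod_filter, Fintype.prod_prod_type, ← prod_prod_ite_eq]
  have h : ∀ i j : Fin N, (if i < j then f i * f j else 1) =
      (if i < j then f i else 1) * (if i < j then f j else 1) := by
    intro i j
    split_ifs <;> simp
  simp only [h, Finset.prod_mul_distrib]
  rw [Finset.prod_comm (f := fun i j => if i < j then f j else 1), ← Finset.prod_mul_distrib]
  refine Finset.prod_congr rfl fun i _ => ?_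
  rw [← Finset.prod_mul_distrib]
  refine Finset.prod_congr rfl fun j _ => ?_
  rcases lt_trichotomy i j with h | h | h
  · simp [h, h.ne, h.not_gt]
  · simp [h]
  · simp [h, h.ne', h.not_gt]

theorem bethe_eq_betheHat {q : ℂ} (c : ℂ) (hq : q ≠ 0) {N : ℕ} (w : Fin N → ℂ)
    (hw : ∀ j, w j ≠ 0) :
    bethe q c w = (∏ i, w i ^ (2 * (N - 1)))⁻¹ • betheHat q c w := by
  rw [bethe_eq_betheOf, betheHat, ← prod_prod_ite_eq_mul]
  simp only [R12_eq_hatLax c hq w hw, ← Finset.prod_inv_distrib]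
  exact betheOf_smul _ _

/-- `f` is a polynomial function of degree at most `d m` in the variable `m`. -/
def IsPolyFun {N : ℕ} (d : Fin N → ℕ) (f : (Fin N → ℂ) → ℂ) : Prop :=
  ∃ P : MvPolynomial (Fin N) ℂ, (∀ w, f w = MvPolynomial.eval w P) ∧ ∀ m, P.degreeOf m ≤ d m

namespace IsPolyFun

variable {N : ℕ} {d d' : Fin N → ℕ} {f g : (Fin N → ℂ) → ℂ}

theorem mono (hf : IsPolyFun d f) (h : d ≤ d') : IsPolyFun d' f := by
  obtain ⟨P, hP, hd⟩ := hf
  exact ⟨P, hP, fun m => (hd m).trans (h m)⟩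

theorem const (d : Fin N → ℕ) (a : ℂ) : IsPolyFun d fun _ => a :=
  ⟨MvPolynomial.C a, by simp, fun m => by simp⟩

theorem coord (i : Fin N) : IsPolyFun (Pi.single i 1) fun w => w i := by
  refine ⟨MvPolynomial.X i, by simp, fun m => ?_⟩
  classical
  rw [MvPolynomial.degreeOf_X, Pi.single_apply]

theorem add (hf : IsPolyFun d f) (hg : IsPolyFun d g) : IsPolyFun d fun w => f w + g w := by
  obtain ⟨P, hP, hd⟩ := hf
  obtain ⟨Q, hQ, hd'⟩ := hg
  exact ⟨P + Q, by simp [hP, hQ], fun m =>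
    (MvPolynomial.degreeOf_add_le m P Q).trans (max_le (hd m) (hd' m))⟩

theorem mul (hf : IsPolyFun d f) (hg : IsPolyFun d' g) :
    IsPolyFun (d + d') fun w => f w * g w := by
  obtain ⟨P, hP, hd⟩ := hf
  obtain ⟨Q, hQ, hd'⟩ := hg
  exact ⟨P * Q, by simp [hP, hQ], fun m =>
    (MvPolynomial.degreeOf_mul_le m P Q).trans (add_le_add (hd m) (hd' m))⟩

theorem sum {ι : Type*} (s : Finset ι) {f : ι → (Fin N → ℂ) → ℂ}
    (hf : ∀ i ∈ s, IsPolyFun d (f i)) : IsPolyFun d fun w => ∑ i ∈ s, f i w := by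
  classical
  induction s using Finset.induction_on with
  | empty => simpa using const d 0
  | insert a s ha ih =>
    simp only [Finset.sum_insert ha]
    exact (hf a (by simp)).add (ih fun i hi => hf i (by simp [hi]))

theorem list_prod {α n : Type*} [Fintype n] [DecidableEq n] (l : List α) (d : α → Fin N → ℕ)
    (F : α → (Fin N → ℂ) → Matrix n n ℂ) (hF : ∀ i a b, IsPolyFun (d i) fun w => F i w a b)
    (a b : n) : IsPolyFun (l.map d).sum fun w => (l.map fun i => F i w).prod a b := by
  induction l generalizing a with
  | nil => simpa using const 0 ((1 : Matrix n n ℂ) a b)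
  | cons x l ih =>
    simp only [List.map_cons, List.prod_cons, List.sum_cons, Matrix.mul_apply]
    exact sum _ fun e _ => (hF x a e).mul (ih e)

theorem eq_of_forall_ne_zero (hf : IsPolyFun d f) (hg : IsPolyFun d' g)
    (h : ∀ w, (∀ j, w j ≠ 0) → f w = g w) (w : Fin N → ℂ) : f w = g w := by
  obtain ⟨P, hP, -⟩ := hf
  obtain ⟨Q, hQ, -⟩ := hg
  suffices hPQ : (P - Q) * ∏ j, MvPolynomial.X j = 0 by
    rcases mul_eq_zero.1 hPQ with h0 | h0
    · rw [hP, hQ, sub_eq_zero.1 h0]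
    · exact absurd h0 (Finset.prod_ne_zero_iff.2 fun j _ => MvPolynomial.X_ne_zero j)
  refine MvPolynomial.funext fun v => ?_
  simp only [map_mul, map_sub, map_prod, MvPolynomial.eval_X, map_zero]
  by_cases hv : ∀ j, v j ≠ 0
  · rw [← hP, ← hQ, h v hv, sub_self, zero_mul]
  · push Not at hv
    obtain ⟨j, hj⟩ := hv
    rw [Finset.prod_eq_zero (Finset.mem_univ j) hj, mul_zero]

end IsPolyFun

theorem lax_apply_eq (q c : ℂ) (s t : Fin 3) (a b : Fin 2) :
    ∃ α β γ : ℂ, ∀ x y, lax q c x y s t a b = α * (x * x) + β * (y * y) + γ * (x * y) := by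
  refine ⟨lax q c 1 0 s t a b, lax q c 0 1 s t a b,
    lax q c 1 1 s t a b - lax q c 1 0 s t a b - lax q c 0 1 s t a b, fun x y => ?_⟩
  unfold lax
  fin_cases s <;> fin_cases t <;> fin_cases a <;> fin_cases b <;>
  simp only [Fin.zero_eta, Fin.mk_one, Fin.reduceFinMk, Matrix.cons_val_zero, Matrix.cons_val_one,
    Matrix.cons_val, Matrix.of_apply, Matrix.zero_apply] <;> ring

theorem isPolyFun_hatLax (q c : ℂ) {N : ℕ} (i j : Fin N) (s t : Fin 3) (a b : Fin 2) :
    IsPolyFun (if i = j then 0 else Pi.single i 2 + Pi.single j 2)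
      fun w => hatLax q c w i j s t a b := by
  unfold hatLax
  split_ifs with h
  · exact IsPolyFun.const _ _
  · obtain ⟨α, β, γ, hl⟩ := lax_apply_eq q c s t a b
    simp only [hl]
    have h2 : ∀ k : Fin N, (Pi.single k 2 : Fin N → ℕ) = Pi.single k 1 + Pi.single k 1 :=
      fun k => by rw [← Pi.single_add]
    have hi := IsPolyFun.coord i
    have hj := IsPolyFun.coord j
    refine IsPolyFun.add (IsPolyFun.add ?_ ?_) ?_
    · refine ((IsPolyFun.const 0 α).mul (hi.mul hi)).mono ?_
      rw [← h2, zero_add]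
      exact le_self_add
    · refine ((IsPolyFun.const 0 β).mul (hj.mul hj)).mono ?_
      rw [← h2, zero_add]
      exact le_add_self
    · refine ((IsPolyFun.const 0 γ).mul (hi.mul hj)).mono ?_
      rw [h2, h2, zero_add]
      exact add_le_add le_self_add le_self_add

theorem isPolyFun_rowOp (q c : ℂ) {N : ℕ} (i : Fin N) (σ τ : Fin N → Fin 3) :
    IsPolyFun (∑ j, if i = j then 0 else Pi.single i 2 + Pi.single j 2)
      fun w => rowOp (hatLax q c w i) σ τ := by
  rw [Fin.sum_univ_def, ← ((List.reverse_perm (List.finRange N)).map _).sum_eq]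
  exact IsPolyFun.list_prod _ _ (fun j w => hatLax q c w i j (σ j) (τ j))
    (fun j a b => isPolyFun_hatLax q c i j (σ j) (τ j) a b) 0 1

theorem isPolyFun_betheHat (q c : ℂ) {N : ℕ} (σ : Fin N → Fin 3) :
    IsPolyFun (fun _ => 4 * (N - 1)) fun w => betheHat q c w σ := by
  have h := IsPolyFun.sum (Finset.univ : Finset (Fin N → Fin 3)) fun τ _ =>
    (IsPolyFun.list_prod (List.finRange N) _ (fun i w => rowOp (hatLax q c w i))
      (fun i σ τ => isPolyFun_rowOp q c i σ τ) σ τ).mul (IsPolyFun.const 0 (vac N τ))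
  rw [← Fin.sum_univ_def, sum_sum_ite_eq_add] at h
  refine h.mono fun m => ?_
  simp only [Pi.add_apply, Finset.sum_apply, Pi.smul_apply, Pi.zero_apply, add_zero, smul_eq_mul]
  rw [Finset.sum_eq_single m (fun k _ hk => by simp [Ne.symm hk]) (by simp)]
  simp only [Pi.single_eq_same]
  omega

theorem lax_self (q c x : ℂ) (s t : Fin 3) : lax q c x x s t = x^2 • lax q c 1 1 s t := by
  ext a b
  unfold lax
  fin_cases s <;> fin_cases t <;> fin_cases a <;> fin_cases b <;>
  simp only [Matrix.smul_apply, smul_eq_mul, Fin.zero_eta, Fin.mk_one, Fin.reduceFinMk, Matrix.cons_val_zero, Matrix.cons_val_one,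
    Matrix.cons_val, Matrix.of_apply, Matrix.zero_apply] <;> ring

theorem rowOp_lax_eq_hatLax (q c : ℂ) {N : ℕ} (w : Fin N → ℂ) (i : Fin N) :
    (rowOp fun j => lax q c (w i) (w j)) = (w i ^ 2) • rowOp (hatLax q c w i) := by
  have h : (fun j => lax q c (w i) (w j)) =
      fun j s t => (if i = j then w i ^ 2 else 1) • hatLax q c w i j s t := by
    funext j s t
    unfold hatLax
    split_ifs with hij
    · subst hij
      exact lax_self q c (w i) s t
    · simp
  rw [h, rowOp_smul, Finset.prod_ite_eq, if_pos (Finset.mem_univ i)]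

theorem rowOp_hatLax_commute {q c : ℂ} (hq : q ≠ 0) (hq4 : q^4 ≠ 1) (hc : c^2 = br q * br (q^2))
    {N : ℕ} (w : Fin N → ℂ) (i k : Fin N) :
    Commute (rowOp (hatLax q c w i)) (rowOp (hatLax q c w k)) := by
  ext σ τ
  simp only [Matrix.mul_apply]
  refine IsPolyFun.eq_of_forall_ne_zero
    (IsPolyFun.sum _ fun ρ _ => (isPolyFun_rowOp q c i σ ρ).mul (isPolyFun_rowOp q c k ρ τ))
    (IsPolyFun.sum _ fun ρ _ => (isPolyFun_rowOp q c k σ ρ).mul (isPolyFun_rowOp q c i ρ τ))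
    (fun v hv => ?_) w
  have h := rowOp_lax_commute hq hq4 hc v (v i) (v k) (hv i)
  rw [rowOp_lax_eq_hatLax, rowOp_lax_eq_hatLax, commute_iff_eq, smul_mul_smul_comm,
    smul_mul_smul_comm, mul_comm (v k ^ 2)] at h
  have h' := smul_right_injective _ (mul_ne_zero (pow_ne_zero 2 (hv i)) (pow_ne_zero 2 (hv k))) h
  simpa only [Matrix.mul_apply] using congrFun₂ h' σ τ

theorem betheHat_eq_of_perm {q c : ℂ} (hq : q ≠ 0) (hq4 : q^4 ≠ 1) (hc : c^2 = br q * br (q^2))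
    {N : ℕ} (w : Fin N → ℂ) {l : List (Fin N)} (hl : l.Perm (List.finRange N)) :
    betheHat q c w = (l.map fun i => rowOp (hatLax q c w i)).prod *ᵥ vac N := by
  rw [betheHat, betheOf, (hl.map _).prod_eq']
  refine List.pairwise_of_forall_mem_list ?_
  simp only [List.mem_map]
  rintro _ ⟨i, -, rfl⟩ _ ⟨k, -, rfl⟩
  exact rowOp_hatLax_commute hq hq4 hc w i k

theorem vac_eq (N : ℕ) : vac N = Pi.single 0 1 := by
  ext σ
  simp only [vac, Pi.single_apply]
  rfl

theorem betheHat_eq_zero {q c : ℂ} (hq : q ≠ 0) (hq4 : q^4 ≠ 1) (hc : c^2 = br q * br (q^2))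
    {N : ℕ} (w : Fin N → ℂ) {j k : Fin N} (hjk : j < k) (hw : ∀ i, w i ≠ 0)
    (h : w k ^ 2 = q^2 * w j ^ 2) : betheHat q c w = 0 := by
  have hl : ((((List.finRange N).erase j).erase k) ++ [j, k]).Perm (List.finRange N) := by
    have h1 := List.perm_cons_erase (List.mem_finRange j)
    have h2 := List.perm_cons_erase
      ((List.mem_erase_of_ne hjk.ne').2 (List.mem_finRange k))
    exact (List.perm_append_comm.trans ((h2.symm).cons j)).trans h1.symm
  rw [betheHat_eq_of_perm hq hq4 hc w hl, List.map_append, List.prod_append,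
    ← Matrix.mulVec_mulVec]
  suffices h0 : (rowOp (hatLax q c w j) * rowOp (hatLax q c w k)) *ᵥ vac N = 0 by
    simp [h0]
  ext σ
  have h1 := rowOp_lax_mul_apply_vac_eq_zero hq hc w hjk (hw j) h σ
  rw [rowOp_lax_eq_hatLax, rowOp_lax_eq_hatLax, smul_mul_smul_comm, Matrix.smul_apply] at h1
  rw [vac_eq, Matrix.mulVec_single_one]
  exact (smul_eq_zero.1 h1).resolve_left
    (mul_ne_zero (pow_ne_zero 2 (hw j)) (pow_ne_zero 2 (hw k)))

theorem list_prod_reverse_finRange_succAbove {R : Type*} [Semiring R] [Algebra ℂ R] {n : ℕ}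
    (j : Fin (n + 1)) (F : Fin (n + 1) → R) (a : ℂ) (h : F j = a • 1) :
    ((List.finRange (n + 1)).reverse.map F).prod =
      a • ((List.finRange n).reverse.map fun i => F (j.succAbove i)).prod := by
  induction n with
  | zero =>
    obtain rfl := Fin.fin_one_eq_zero j
    simp [List.finRange_succ, h]
  | succ n ih =>
    rw [List.finRange_succ, List.reverse_cons, List.map_append, List.prod_append,
      ← List.map_reverse, List.map_map]
    rcases Fin.eq_zero_or_eq_succ j with rfl | ⟨k, rfl⟩
    · simp [h, Function.comp_def]
    · rw [Function.comp_def, ih k (fun i => F i.succ) h, List.finRange_succ, List.reverse_cons,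
        List.map_append, List.prod_append, ← List.map_reverse, List.map_map]
      simp [Function.comp_def]

/-- Insertion of the state `0` at site `j`. -/
def embed {n : ℕ} (j : Fin (n + 1)) (v : (Fin n → Fin 3) → ℂ) : (Fin (n + 1) → Fin 3) → ℂ :=
  fun σ => if σ j = 1 then v (j.removeNth σ) else 0

theorem lax_zero_right_one (q c x : ℂ) (s : Fin 3) :
    lax q c x 0 s 1 = (if s = 1 then x^2 else 0) • 1 := by
  unfold lax
  ext a b
  fin_cases s <;> fin_cases a <;> fin_cases b <;>
  simp only [Fin.zero_eta, Fin.mk_one, Fin.reduceFinMk, Matrix.cons_val_zero, Matrix.cons_val_one,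
    Matrix.cons_val, Matrix.of_apply] <;> simp

theorem hatLax_succAbove (q c : ℂ) {n : ℕ} (w : Fin (n + 1) → ℂ) (j : Fin (n + 1)) (i k : Fin n) :
    hatLax q c w (j.succAbove i) (j.succAbove k) =
      hatLax q c (fun i => w (j.succAbove i)) i k := by
  simp only [hatLax, Fin.succAbove_right_inj]

theorem rowOp_hatLax_mulVec_embed (q c : ℂ) {n : ℕ} {w : Fin (n + 1) → ℂ} {j : Fin (n + 1)}
    (hj : w j = 0) (i : Fin n) (v : (Fin n → Fin 3) → ℂ) :
    rowOp (hatLax q c w (j.succAbove i)) *ᵥ embed j v =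
      w (j.succAbove i) ^ 2 •
        embed j (rowOp (hatLax q c (fun i => w (j.succAbove i)) i) *ᵥ v) := by
  ext σ
  rw [Matrix.mulVec, dotProduct, ← (Fin.insertNthEquiv (fun _ => Fin 3) j).sum_comp,
    Fintype.sum_prod_type, Finset.sum_eq_single 1]
  · have h : ∀ τ : Fin n → Fin 3, rowOp (hatLax q c w (j.succAbove i)) σ (j.insertNth 1 τ) =
        (if σ j = 1 then w (j.succAbove i) ^ 2 else 0) *
          rowOp (hatLax q c (fun i => w (j.succAbove i)) i) (j.removeNth σ) τ := by
      intro τ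
      rw [rowOp, Matrix.of_apply, list_prod_reverse_finRange_succAbove j _
        (if σ j = 1 then w (j.succAbove i) ^ 2 else 0)]
      · simp only [Fin.insertNth_apply_succAbove, hatLax_succAbove, Matrix.smul_apply]
        rfl
      · rw [hatLax, if_neg (Fin.succAbove_ne j i), hj, Fin.insertNth_apply_same,
          lax_zero_right_one]
    have he : ∀ τ : Fin n → Fin 3,
      Fin.insertNthEquiv (fun _ => Fin 3) j (1, τ) = j.insertNth 1 τ := fun _ => rfl
    simp only [he, h, embed, Fin.insertNth_apply_same, if_true,
      Fin.removeNth_insertNth, Pi.smul_apply, smul_eq_mul, Matrix.mulVec, dotProduct]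
    split_ifs
    · simp [Finset.mul_sum, mul_assoc]
    · simp
  · intro t _ ht
    refine Finset.sum_eq_zero fun τ _ => ?_
    simp [embed, ht]
  · simp

theorem hatLax_zero_zero (q c : ℂ) {N : ℕ} {w : Fin N → ℂ} {j : Fin N} (hj : w j = 0) {s : Fin N}
    (hs : s ≠ j) (t : Fin 3) :
    hatLax q c w j s t 0 =
      if t = 0 then Matrix.diagonal ![-(q⁻¹ * w s ^ 2), -(q * w s ^ 2)] else 0 := by
  rw [hatLax, if_neg hs.symm, hj]
  unfold lax
  ext a b
  fin_cases t <;> fin_cases a <;> fin_cases b <;>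
  simp only [Fin.zero_eta, Fin.mk_one, Fin.reduceFinMk, Matrix.cons_val_zero, Matrix.cons_val_one,
    Matrix.cons_val, Matrix.of_apply, Matrix.zero_apply] <;> simp

theorem list_prod_map_diagonal {α : Type*} (l : List α) (d : α → Fin 2 → ℂ) :
    (l.map fun s => Matrix.diagonal (d s)).prod = Matrix.diagonal (l.map d).prod := by
  have h := map_list_prod (Matrix.diagonalRingHom (Fin 2) ℂ) (l.map d)
  rw [List.map_map] at h
  exact h.symm

theorem rowOp_hatLax_mulVec_vac {q c : ℂ} (hq : q ≠ 0) (hc : c ≠ 0) {n : ℕ}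
    {w : Fin (n + 1) → ℂ} {j : Fin (n + 1)} (hj : w j = 0) (hw : ∀ i, i ≠ j → w i ≠ 0) :
    ∃ κ : ℂ, κ ≠ 0 ∧ rowOp (hatLax q c w j) *ᵥ vac (n + 1) = κ • embed j (vac n) := by
  have hF : ∀ s ≠ j, ∀ t, hatLax q c w j s t 0 =
      if t = 0 then Matrix.diagonal ![-(q⁻¹ * w s ^ 2), -(q * w s ^ 2)] else 0 :=
    fun s hs t => hatLax_zero_zero q c hj hs t
  have hj' : ∀ t, hatLax q c w j j t 0 = lax q c 1 1 t 0 := fun t => by rw [hatLax, if_pos rfl]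
  have hdiag : ∀ l : List (Fin (n + 1)), j ∉ l → ∃ α δ : ℂ, α ≠ 0 ∧ δ ≠ 0 ∧
      ∀ σ : Fin (n + 1) → Fin 3, (∀ s, s ≠ j → σ s = 0) →
      (l.map fun s => hatLax q c w j s (σ s) 0).prod = Matrix.diagonal ![α, δ] := by
    intro l hl
    have hne : ∀ a, (l.map fun s => ![-(q⁻¹ * w s ^ 2), -(q * w s ^ 2)]).prod a ≠ 0 := by
      intro a
      rw [Pi.list_prod_apply, List.map_map]
      refine List.prod_ne_zero fun h0 => ?_
      obtain ⟨s, hs, h0⟩ := List.mem_map.1 h0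
      have hs' : s ≠ j := fun h => hl (h ▸ hs)
      have := hw s hs'
      revert h0
      fin_cases a <;> simp [hq, this]
    refine ⟨_, _, hne 0, hne 1, fun σ hσ => ?_⟩
    rw [← List.map_congr_left (f := fun s => Matrix.diagonal ![-(q⁻¹ * w s ^ 2), -(q * w s ^ 2)]),
      list_prod_map_diagonal]
    · congr 1
      ext a
      fin_cases a <;> rfl
    · intro s hs
      have hs' : s ≠ j := fun h => hl (h ▸ hs)
      rw [hF s hs', if_pos (hσ s hs')]
  obtain ⟨l₁, l₂, hl⟩ := List.append_of_mem (List.mem_reverse.2 (List.mem_finRange j))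
  have hnd := List.nodup_reverse.2 (List.nodup_finRange (n + 1))
  rw [hl] at hnd
  have hn1 : j ∉ l₁ := fun h =>
    (List.disjoint_of_nodup_append hnd) h (by simp)
  have hn2 : j ∉ l₂ := (List.nodup_cons.1 (List.Nodup.of_append_right hnd)).1
  obtain ⟨α₁, δ₁, hα₁, hδ₁, h1⟩ := hdiag l₁ hn1
  obtain ⟨α₂, δ₂, hα₂, hδ₂, h2⟩ := hdiag l₂ hn2
  refine ⟨α₁ * c * δ₂, mul_ne_zero (mul_ne_zero hα₁ hc) hδ₂, ?_⟩
  ext σ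
  rw [vac_eq, vac_eq, Matrix.mulVec_single_one, Matrix.col_apply, rowOp, Matrix.of_apply,
    Pi.smul_apply, embed]
  by_cases hσ : ∀ s, s ≠ j → σ s = 0
  · have h0 : j.removeNth σ = 0 := funext fun i => hσ _ (Fin.succAbove_ne j i)
    simp only [Pi.zero_apply]
    rw [hl, List.map_append, List.map_cons, List.prod_append, List.prod_cons, h1 σ hσ, h2 σ hσ,
      hj', h0, Matrix.diagonal_mul, Matrix.mul_diagonal]
    generalize σ j = t
    unfold lax
    fin_cases t <;>
    simp only [Fin.zero_eta, Fin.mk_one, Fin.reduceFinMk, Matrix.cons_val_zero, Matrix.cons_val_one,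
      Matrix.cons_val] <;> simp [mul_assoc]
  · push Not at hσ
    obtain ⟨s, hs, h0⟩ := hσ
    rw [List.prod_eq_zero, Matrix.zero_apply]
    · obtain ⟨i, rfl⟩ := Fin.exists_succAbove_eq hs
      have h0' : j.removeNth σ ≠ 0 := fun h => h0 (congrFun h i)
      simp [h0']
    · refine List.mem_map.2 ⟨s, by simp, ?_⟩
      rw [Pi.zero_apply, hF s hs, if_neg h0]

theorem list_prod_mulVec_embed (q c : ℂ) {n : ℕ} {w : Fin (n + 1) → ℂ} {j : Fin (n + 1)}
    (hj : w j = 0) (l : List (Fin n)) (v : (Fin n → Fin 3) → ℂ) :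
    (l.map fun i => rowOp (hatLax q c w (j.succAbove i))).prod *ᵥ embed j v =
      (l.map fun i => w (j.succAbove i) ^ 2).prod •
        embed j ((l.map fun i => rowOp (hatLax q c (fun i => w (j.succAbove i)) i)).prod *ᵥ v) := by
  induction l with
  | nil => simp
  | cons i l ih =>
    simp only [List.map_cons, List.prod_cons, ← Matrix.mulVec_mulVec, ih, Matrix.mulVec_smul,
      rowOp_hatLax_mulVec_embed q c hj]
    rw [smul_smul, mul_comm]

theorem exists_betheHat_eq_smul_embed {q c : ℂ} (hq : q ≠ 0) (hq4 : q^4 ≠ 1)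
    (hc : c^2 = br q * br (q^2)) (hc0 : c ≠ 0) {n : ℕ}
    {w : Fin (n + 1) → ℂ} {j : Fin (n + 1)} (hj : w j = 0) (hw : ∀ i, i ≠ j → w i ≠ 0) :
    ∃ κ : ℂ, κ ≠ 0 ∧
      betheHat q c w = κ • embed j (betheHat q c fun i => w (j.succAbove i)) := by
  obtain ⟨κ, hκ, h⟩ := rowOp_hatLax_mulVec_vac hq hc0 hj hw
  have hl : ((List.finRange n).map j.succAbove ++ [j]).Perm (List.finRange (n + 1)) := by
    refine (List.perm_ext_iff_of_nodup ?_ (List.nodup_finRange _)).2 fun i => ?_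
    · refine List.Nodup.append ((List.nodup_finRange n).map Fin.succAbove_right_injective)
        (List.nodup_singleton j) ?_
      simp
    · by_cases hi : i = j
      · simp [hi]
      · simpa using Or.inl (Fin.exists_succAbove_eq hi)
  refine ⟨κ * ((List.finRange n).map fun i => w (j.succAbove i) ^ 2).prod,
    mul_ne_zero hκ (List.prod_ne_zero fun h0 => ?_), ?_⟩
  · obtain ⟨i, -, h0⟩ := List.mem_map.1 h0
    exact pow_ne_zero 2 (hw _ (Fin.succAbove_ne j i)) h0
  · rw [betheHat_eq_of_perm hq hq4 hc w hl, List.map_append, List.prod_append,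
      ← Matrix.mulVec_mulVec, List.map_singleton, List.prod_singleton, h, Matrix.mulVec_smul,
      List.map_map, Function.comp_def, list_prod_mulVec_embed q c hj, smul_smul]
    rfl

theorem ne_zero_of_sq_eq {q c : ℂ} (hq : q ≠ 0) (hq4 : q^4 ≠ 1) (hc : c^2 = br q * br (q^2)) :
    c ≠ 0 := by
  rintro rfl
  refine hq4 ?_
  rw [br, br] at hc
  field_simp at hc
  rcases mul_eq_zero.1 (show (q^2 - 1) * (q^4 - 1) = 0 by linear_combination -hc) with h | h
  · linear_combination (q^2 + 1) * h
  · linear_combination h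

/-- The all-`0` component of the Bethe vector does not vanish identically. -/
theorem exists_betheHat_one_ne_zero {q c : ℂ} (hq : q ≠ 0) (hq4 : q^4 ≠ 1)
    (hc : c^2 = br q * br (q^2)) (N : ℕ) :
    ∃ w : Fin N → ℂ, (∀ i, w i ≠ 0) ∧ betheHat q c w 1 ≠ 0 := by
  induction N with
  | zero => exact ⟨0, fun i => i.elim0, by
      simp [betheHat, betheOf, vac_eq, Subsingleton.elim (1 : Fin 0 → Fin 3) 0]⟩
  | succ n ih =>
    obtain ⟨w', hw', h⟩ := ih
    by_contra! h0
    have h1 := IsPolyFun.eq_of_forall_ne_zero (isPolyFun_betheHat q c 1)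
      (IsPolyFun.const 0 0) h0 (Fin.cons 0 w')
    obtain ⟨κ, hκ, h2⟩ := exists_betheHat_eq_smul_embed hq hq4 hc (ne_zero_of_sq_eq hq hq4 hc)
      (w := Fin.cons 0 w') (j := 0) rfl (fun i hi => by
        obtain ⟨k, rfl⟩ := Fin.exists_succ_eq.2 hi
        simpa using hw' k)
    rw [h2] at h1
    simp only [Pi.smul_apply, embed, Pi.one_apply, if_true, smul_eq_mul, mul_eq_zero, hκ,
      false_or, Fin.zero_succAbove, Fin.cons_succ] at h1
    exact h h1

theorem exists_betheHat_one_ne_zero_of_eq_zero {q c : ℂ} (hq : q ≠ 0) (hq4 : q^4 ≠ 1)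
    (hc : c^2 = br q * br (q^2)) {N : ℕ} (j : Fin N) :
    ∃ w : Fin N → ℂ, w j = 0 ∧ (∀ i, i ≠ j → w i ≠ 0) ∧ betheHat q c w 1 ≠ 0 := by
  obtain ⟨n, rfl⟩ : ∃ n, N = n + 1 := ⟨N - 1, by have := j.pos; omega⟩
  obtain ⟨w', hw', h⟩ := exists_betheHat_one_ne_zero hq hq4 hc n
  have hj : (j.insertNth 0 w' : Fin (n + 1) → ℂ) j = 0 := Fin.insertNth_apply_same ..
  have hw : ∀ i, i ≠ j → (j.insertNth 0 w' : Fin (n + 1) → ℂ) i ≠ 0 := fun i hi => by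
    obtain ⟨k, rfl⟩ := Fin.exists_succAbove_eq hi
    simpa using hw' k
  obtain ⟨κ, hκ, h2⟩ := exists_betheHat_eq_smul_embed hq hq4 hc (ne_zero_of_sq_eq hq hq4 hc) hj hw
  refine ⟨_, hj, hw, ?_⟩
  rw [h2]
  simp only [Fin.insertNth_apply_succAbove]
  exact smul_ne_zero hκ (by rwa [embed, if_pos (Pi.one_apply j)])

theorem br_inv (z : ℂ) : br z⁻¹ = -br z := by
  rw [br, br, inv_inv, neg_sub]

theorem lax_inv {q : ℂ} (c : ℂ) {x y : ℂ} (hx : x ≠ 0) (hy : y ≠ 0) (s t : Fin 3) :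
    lax q⁻¹ (-c) x⁻¹ y⁻¹ s t = (-((x * y) ^ 2)⁻¹) • lax q c x y s t := by
  unfold lax
  ext a b
  rw [inv_inv]
  generalize q⁻¹ = p
  fin_cases s <;> fin_cases t <;> fin_cases a <;> fin_cases b <;>
  simp only [Matrix.smul_apply, smul_eq_mul, Fin.zero_eta, Fin.mk_one, Fin.reduceFinMk,
    Matrix.cons_val_zero, Matrix.cons_val_one, Matrix.cons_val, Matrix.of_apply,
    Matrix.zero_apply] <;> field_simp <;> ring

theorem hatLax_inv {q : ℂ} (c : ℂ) {N : ℕ} {w : Fin N → ℂ} (hw : ∀ i, w i ≠ 0)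
    (i j : Fin N) (s t : Fin 3) :
    hatLax q⁻¹ (-c) w⁻¹ i j s t =
      (-(if i = j then 1 else w i ^ 2 * w j ^ 2)⁻¹) • hatLax q c w i j s t := by
  unfold hatLax
  split_ifs
  · simpa using lax_inv (q := q) c one_ne_zero one_ne_zero s t
  · rw [← mul_pow]
    exact lax_inv c (hw i) (hw j) s t

theorem betheHat_inv {q : ℂ} (c : ℂ) {N : ℕ} {w : Fin N → ℂ} (hw : ∀ i, w i ≠ 0) :
    betheHat q⁻¹ (-c) w⁻¹ =
      ((-1) ^ (N * N) * (∏ i, w i ^ (4 * (N - 1)))⁻¹) • betheHat q c w := by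
  have h : (hatLax q⁻¹ (-c) w⁻¹) = fun i j s t =>
      (-(if i = j then 1 else w i ^ 2 * w j ^ 2)⁻¹) • hatLax q c w i j s t := by
    funext i j s t
    exact hatLax_inv c hw i j s t
  rw [betheHat, h, betheOf_smul]
  congr 1
  have h' := prod_prod_ite_eq_mul fun i => w i ^ 2
  simp only [← pow_mul, ← mul_assoc] at h'
  norm_num at h'
  simp only [← neg_one_mul (_⁻¹), Finset.prod_mul_distrib, Finset.prod_inv_distrib, h',
    Finset.prod_const, Finset.card_univ, Fintype.card_fin, ← pow_mul]

theorem exists_continuous_pow_mul_eval_update {N : ℕ} (P : MvPolynomial (Fin N) ℂ) {j : Fin N}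
    {D : ℕ} (h : P.degreeOf j < D) (u : Fin N → ℂ) :
    ∃ g : ℂ → ℂ, Continuous g ∧
      ∀ s ≠ 0, s ^ D * MvPolynomial.eval (Function.update u j s⁻¹) P = s * g s := by
  refine ⟨fun s => ∑ m ∈ P.support, P.coeff m *
    (s ^ (D - 1 - m j) * ∏ i ∈ Finset.univ.erase j, u i ^ m i), by fun_prop, fun s hs => ?_⟩
  rw [MvPolynomial.eval_eq', Finset.mul_sum, Finset.mul_sum]
  refine Finset.sum_congr rfl fun m hm => ?_
  have hmj : m j ≤ P.degreeOf j := MvPolynomial.monomial_le_degreeOf j hm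
  have hD : D = 1 + (D - 1 - m j) + m j := by omega
  rw [← Finset.mul_prod_erase _ _ (Finset.mem_univ j), Function.update_self,
    Finset.prod_congr rfl fun i hi => by rw [Function.update_of_ne (Finset.ne_of_mem_erase hi)]]
  nth_rewrite 1 [hD]
  rw [pow_add, pow_add, inv_pow]
  field_simp

theorem degreeOf_betheHat_one {q c : ℂ} (hq : q ≠ 0) (hq4 : q^4 ≠ 1) (hc : c^2 = br q * br (q^2))
    {N : ℕ} {P : MvPolynomial (Fin N) ℂ} (hP : ∀ w, betheHat q c w 1 = MvPolynomial.eval w P)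
    (j : Fin N) : 4 * (N - 1) ≤ P.degreeOf j := by
  by_contra! hlt
  obtain ⟨v, hj, hv, h0⟩ := exists_betheHat_one_ne_zero_of_eq_zero (q := q⁻¹) (c := -c)
    (inv_ne_zero hq) (by rwa [inv_pow, ne_eq, inv_eq_one])
    (by rw [neg_sq, hc, inv_pow, br_inv, br_inv, neg_mul_neg]) j
  obtain ⟨g, hg, hg'⟩ := exists_continuous_pow_mul_eval_update P hlt v⁻¹
  obtain ⟨P', hP', -⟩ := isPolyFun_betheHat q⁻¹ (-c) (1 : Fin N → Fin 3)
  have h : ∀ s ∈ ({0}ᶜ : Set ℂ), betheHat q⁻¹ (-c) (Function.update v j s) 1 =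
      (-1) ^ (N * N) * (∏ i ∈ Finset.univ.erase j, v⁻¹ i ^ (4 * (N - 1)))⁻¹ * (s * g s) := by
    intro s hs
    have hw : ∀ i, Function.update v⁻¹ j s⁻¹ i ≠ 0 := by
      intro i
      by_cases hi : i = j
      · subst hi
        simpa using hs
      · simpa [hi] using hv i hi
    have hvw : Function.update v j s = (Function.update v⁻¹ j s⁻¹)⁻¹ := by
      ext i
      by_cases hi : i = j
      · subst hi
        simp
      · simp [hi]
    rw [hvw, betheHat_inv c hw, ← hg' s hs, Pi.smul_apply, hP, smul_eq_mul,
      ← Finset.mul_prod_erase _ _ (Finset.mem_univ j), Function.update_self,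
      Finset.prod_congr rfl fun i hi => by rw [Function.update_of_ne (Finset.ne_of_mem_erase hi)],
      mul_inv, inv_pow, inv_inv]
    ring
  have h1 := Continuous.ext_on (dense_compl_singleton (0 : ℂ))
    (f := fun s => betheHat q⁻¹ (-c) (Function.update v j s) 1) (by
      simp only [hP']
      exact (MvPolynomial.continuous_eval P').comp (by fun_prop)) (by fun_prop) h
  have h2 := congrFun h1 0
  simp only [zero_mul, mul_zero] at h2
  rw [← hj, Function.update_eq_self, hj] at h2
  exact h0 h2

section Divisibility

open MvPolynomial

variable {N : ℕ}

/-- The linear form `X k - a X j`. -/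
def linForm (a : ℂ) (j k : Fin N) : MvPolynomial (Fin N) ℂ := X k - C a * X j

/-- Substitution of `a X j` for `X k`. -/
def linSubst (a : ℂ) (j k : Fin N) : MvPolynomial (Fin N) ℂ →ₐ[ℂ] MvPolynomial (Fin N) ℂ :=
  aeval (Function.update X k (C a * X j))

theorem eval_linSubst (a : ℂ) (j k : Fin N) (P : MvPolynomial (Fin N) ℂ) (v : Fin N → ℂ) :
    eval v (linSubst a j k P) = eval (Function.update v k (a * v j)) P := by
  rw [linSubst, ← coe_aeval_eq_eval, ← coe_aeval_eq_eval, RingHom.coe_coe, RingHom.coe_coe,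
    comp_aeval_apply]
  congr 2
  funext i
  by_cases hi : i = k
  · subst hi
    simp
  · simp [hi]

theorem linForm_dvd_iff {a : ℂ} {j k : Fin N} (hjk : j ≠ k) {P : MvPolynomial (Fin N) ℂ} :
    linForm a j k ∣ P ↔ linSubst a j k P = 0 := by
  constructor
  · rintro ⟨Q, rfl⟩
    rw [map_mul, linForm, map_sub, map_mul]
    simp [linSubst, hjk, algHom_C]
  · intro h
    have hcomp : (Ideal.Quotient.mkₐ ℂ (Ideal.span {linForm a j k})).comp (linSubst a j k) =
        Ideal.Quotient.mkₐ ℂ (Ideal.span {linForm a j k}) := by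
      refine algHom_ext fun i => ?_
      by_cases hi : i = k
      · subst hi
        rw [AlgHom.comp_apply, linSubst, aeval_X, Function.update_self, Ideal.Quotient.mkₐ_eq_mk,
          eq_comm, Ideal.Quotient.eq]
        exact Ideal.mem_span_singleton_self _
      · simp [linSubst, hi]
    have h1 := DFunLike.congr_fun hcomp P
    rw [AlgHom.comp_apply, h, map_zero, Ideal.Quotient.mkₐ_eq_mk, eq_comm,
      Ideal.Quotient.eq_zero_iff_mem, Ideal.mem_span_singleton] at h1
    exact h1

theorem linForm_prime {a : ℂ} {j k : Fin N} (hjk : j ≠ k) : Prime (linForm a j k) := by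
  refine ⟨fun h => ?_, fun h => ?_, fun P Q h => ?_⟩
  · have := congrArg (eval (Pi.single k 1)) h
    simp [linForm, hjk] at this
  · have := h.map (linSubst a j k)
    rw [(linForm_dvd_iff hjk).1 dvd_rfl] at this
    exact not_isUnit_zero this
  · simpa only [linForm_dvd_iff hjk, map_mul, mul_eq_zero] using h

theorem linForm_dvd_of_forall_eval {a : ℂ} (ha : a ≠ 0) {j k : Fin N} (hjk : j ≠ k)
    {P : MvPolynomial (Fin N) ℂ}
    (h : ∀ w : Fin N → ℂ, (∀ i, w i ≠ 0) → w k = a * w j → eval w P = 0) :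
    linForm a j k ∣ P := by
  rw [linForm_dvd_iff hjk]
  have hX : (∏ i, X i : MvPolynomial (Fin N) ℂ) ≠ 0 :=
    Finset.prod_ne_zero_iff.2 fun i _ => X_ne_zero i
  refine (mul_eq_zero.1 (MvPolynomial.funext fun v => ?_)).resolve_right hX
  simp only [map_mul, map_prod, eval_X, map_zero, eval_linSubst]
  by_cases hv : ∀ i, v i ≠ 0
  · rw [h, zero_mul]
    · intro i
      by_cases hi : i = k
      · subst hi
        simp [ha, hv]
      · simp [hi, hv]
    · simp [hjk]
  · push Not at hv
    obtain ⟨i, hi⟩ := hv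
    rw [Finset.prod_eq_zero (Finset.mem_univ i) hi, mul_zero]

theorem linForm_not_dvd {a a' : ℂ} (ha' : a' ≠ 0) {j k j' k' : Fin N} (hjk : j < k)
    (hjk' : j' < k') (h : (j, k, a) ≠ (j', k', a')) :
    ¬ linForm a j k ∣ linForm a' j' k' := by
  rw [linForm_dvd_iff hjk.ne]
  intro h0
  have h1 : ∀ v : Fin N → ℂ, Function.update v k (a * v j) k' =
      a' * Function.update v k (a * v j) j' := fun v => by
    have := congrArg (eval v) h0
    rw [eval_linSubst] at this
    simpa [linForm, sub_eq_zero] using this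
  by_cases hk : k' = k
  · subst hk
    by_cases hj : j' = j
    · subst hj
      have := h1 1
      simp [hjk.ne] at this
      simp [this] at h
    · have := h1 (Pi.single j' 1)
      simp [Ne.symm hj, hjk'.ne] at this
      exact ha' this.symm
  · by_cases hj : k' = j
    · subst hj
      have := h1 (Pi.single j' 1)
      simp [hjk.ne, hjk'.ne', (hjk'.trans hjk).ne] at this
      exact ha' this.symm
    · have := h1 (Pi.single k' 1)
      by_cases hjk2 : j' = k
      · subst hjk2
        simp [hk, Ne.symm hj] at this
      · simp [hk, Ne.symm hj, hjk'.ne, hjk2] at this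

/-- The numerator of the normalisation of the Bethe vector. -/
def normPoly (q : ℂ) (N : ℕ) : MvPolynomial (Fin N) ℂ :=
  ∏ pr ∈ Finset.univ.filter (fun pr : Fin N × Fin N => pr.1 < pr.2),
    (X pr.2 ^ 2 - C (q^2) * X pr.1 ^ 2)

theorem normPoly_dvd {q : ℂ} (hq : q ≠ 0) {P : MvPolynomial (Fin N) ℂ}
    (h : ∀ w : Fin N → ℂ, ∀ j k : Fin N, j < k → (∀ i, w i ≠ 0) → w k ^ 2 = q^2 * w j ^ 2 →
      eval w P = 0) : normPoly q N ∣ P := by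
  have hfac : normPoly q N =
      ∏ x ∈ (Finset.univ.filter (fun pr : Fin N × Fin N => pr.1 < pr.2)) ×ˢ
        (Finset.univ : Finset Bool), linForm (if x.2 then q else -q) x.1.1 x.1.2 := by
    rw [Finset.prod_product, normPoly]
    refine Finset.prod_congr rfl fun pr _ => ?_
    rw [Fintype.prod_bool]
    simp only [linForm, if_true, Bool.false_eq_true, if_false, map_neg, map_pow]
    ring
  have hε : ∀ b : Bool, (if b then q else -q) ≠ 0 := fun b => by cases b <;> simp [hq]
  rw [hfac]
  refine Finset.prod_dvd_of_isRelPrime ?_ ?_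
  · rintro ⟨⟨j, k⟩, b⟩ hx ⟨⟨j', k'⟩, b'⟩ hx' hne
    simp only [Finset.coe_product, Set.mem_prod, Finset.mem_coe, Finset.mem_filter,
      Finset.mem_univ, true_and, and_true] at hx hx'
    refine ((linForm_prime hx.ne).irreducible.isRelPrime_iff_not_dvd).2
      (linForm_not_dvd (hε b') hx hx' fun h => hne ?_)
    simp only [Prod.mk.injEq] at h ⊢
    refine ⟨⟨h.1, h.2.1⟩, ?_⟩
    have h2 := h.2.2
    cases b <;> cases b' <;> simp_all [self_eq_neg, neg_eq_self]
  · rintro ⟨⟨j, k⟩, b⟩ hx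
    simp only [Finset.mem_product, Finset.mem_filter, Finset.mem_univ, true_and, and_true] at hx
    refine linForm_dvd_of_forall_eval (hε b) hx.ne fun w hw hk => h w j k hx hw ?_
    rw [hk]
    cases b <;> simp [mul_pow]

theorem normPoly_factor_degreeOf {q : ℂ} (hq : q ≠ 0) {j k : Fin N} (hjk : j < k) (m : Fin N) :
    (X k ^ 2 - C (q^2) * X j ^ 2 : MvPolynomial (Fin N) ℂ).degreeOf m =
      (Pi.single j 2 + Pi.single k 2 : Fin N → ℕ) m := by
  have hq2 : (q^2) ∈ nonZeroDivisors ℂ := mem_nonZeroDivisors_of_ne_zero (pow_ne_zero 2 hq)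
  have hne : (Finsupp.single j 2 : Fin N →₀ ℕ) ≠ Finsupp.single k 2 := fun h =>
    hjk.ne (Finsupp.single_left_injective two_ne_zero h)
  refine le_antisymm ((degreeOf_sub_le m _ _).trans ?_) ?_
  · rw [degreeOf_C_mul _ _ hq2, degreeOf_pow_eq _ _ _ (X_ne_zero k),
      degreeOf_pow_eq _ _ _ (X_ne_zero j), degreeOf_X, degreeOf_X]
    by_cases hj : m = j
    · subst hj
      simp [hjk.ne]
    · by_cases hk : m = k
      · subst hk
        simp [hjk.ne']
      · simp [hj, hk]
  · by_cases hj : m = j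
    · subst hj
      refine le_trans (by simp [hjk.ne]) (monomial_le_degreeOf (m := Finsupp.single m 2) m ?_)
      rw [mem_support_iff, coeff_sub, coeff_C_mul, coeff_X_pow, coeff_X_pow, if_neg hne.symm]
      simp [hq]
    · by_cases hk : m = k
      · subst hk
        refine le_trans (by simp [hjk.ne']) (monomial_le_degreeOf (m := Finsupp.single m 2) m ?_)
        rw [mem_support_iff, coeff_sub, coeff_C_mul, coeff_X_pow, coeff_X_pow, if_neg hne]
        simp
      · simp [hj, hk]

theorem normPoly_factor_ne_zero {q : ℂ} {j k : Fin N} (hjk : j < k) :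
    (X k ^ 2 - C (q^2) * X j ^ 2 : MvPolynomial (Fin N) ℂ) ≠ 0 := fun h => by
  have := congrArg (eval (Pi.single k 1)) h
  simp [hjk.ne] at this

theorem normPoly_ne_zero (q : ℂ) (N : ℕ) : normPoly q N ≠ 0 :=
  Finset.prod_ne_zero_iff.2 fun _ h => normPoly_factor_ne_zero (Finset.mem_filter.1 h).2

theorem degreeOf_normPoly {q : ℂ} (hq : q ≠ 0) (m : Fin N) :
    (normPoly q N).degreeOf m = 2 * (N - 1) := by
  rw [normPoly, degreeOf_prod_eq _ _ fun _ h =>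
      normPoly_factor_ne_zero (Finset.mem_filter.1 h).2,
    Finset.sum_congr rfl fun _ h => normPoly_factor_degreeOf hq (Finset.mem_filter.1 h).2 m,
    ← Finset.sum_apply, sum_lt_add (fun i : Fin N => (Pi.single i 2 : Fin N → ℕ)),
    Finset.sum_apply, Finset.sum_eq_single m (fun k _ hk => by simp [Ne.symm hk]) (by simp)]
  simp [mul_comm]

end Divisibility

theorem eval_normPoly_ne_zero {q : ℂ} {N : ℕ} {w : Fin N → ℂ} (hw : goodW q w) :
    MvPolynomial.eval w (normPoly q N) ≠ 0 := by
  rw [normPoly, map_prod]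
  refine Finset.prod_ne_zero_iff.2 fun pr hpr h => ?_
  have h1 := hw.2 pr.1 pr.2 (Finset.mem_filter.1 hpr).2
  have h2 := hw.1 pr.2
  rw [ne_eq, ne_eq, div_eq_iff h2, div_eq_iff h2] at h1
  simp only [map_sub, map_mul, map_pow, MvPolynomial.eval_X, MvPolynomial.eval_C] at h
  rcases mul_eq_zero.1 (show (w pr.2 - q * w pr.1) * (w pr.2 + q * w pr.1) = 0 by
    linear_combination h) with h0 | h0
  · exact h1.1 (by linear_combination -h0)
  · exact h1.2 (by linear_combination h0)

theorem goodW_of_eval_normPoly_ne_zero {q : ℂ} {N : ℕ} {w : Fin N → ℂ} (hw : ∀ i, w i ≠ 0)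
    (h : MvPolynomial.eval w (normPoly q N) ≠ 0) : goodW q w := by
  refine ⟨hw, fun j k hjk => ?_⟩
  rw [normPoly, map_prod] at h
  have h1 := Finset.prod_ne_zero_iff.1 h (j, k) (by simpa using hjk)
  simp only [map_sub, map_mul, map_pow, MvPolynomial.eval_X, MvPolynomial.eval_C] at h1
  rw [ne_eq, ne_eq, div_eq_iff (hw k), div_eq_iff (hw k)]
  exact ⟨fun h2 => h1 (by linear_combination (-(w k) - q * w j) * h2),
    fun h2 => h1 (by linear_combination (w k - q * w j) * h2)⟩

theorem prod_br {q : ℂ} (hq : q ≠ 0) {N : ℕ} {w : Fin N → ℂ} (hw : ∀ i, w i ≠ 0) :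
    ∏ pr ∈ Finset.univ.filter (fun pr : Fin N × Fin N => pr.1 < pr.2),
      br (q * w pr.1 / w pr.2) =
    MvPolynomial.eval w (normPoly q N) /
      ((-q) ^ (Finset.univ.filter (fun pr : Fin N × Fin N => pr.1 < pr.2)).card *
        ∏ k, w k ^ (N - 1)) := by
  rw [← prod_lt_mul, ← Finset.prod_const, ← Finset.prod_mul_distrib, normPoly, map_prod,
    ← Finset.prod_div_distrib]
  refine Finset.prod_congr rfl fun pr _ => ?_
  have h1 := hw pr.1
  have h2 := hw pr.2
  simp only [map_sub, map_mul, map_pow, MvPolynomial.eval_X, MvPolynomial.eval_C, br]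
  field_simp
  ring

theorem MvPolynomial.eq_of_forall_goodW {q : ℂ} {N : ℕ} {p p' : MvPolynomial (Fin N) ℂ}
    (h : ∀ w, goodW q w → MvPolynomial.eval w p = MvPolynomial.eval w p') : p = p' := by
  have hne : normPoly q N * ∏ i, MvPolynomial.X i ≠ 0 :=
    mul_ne_zero (normPoly_ne_zero q N)
      (Finset.prod_ne_zero_iff.2 fun i _ => MvPolynomial.X_ne_zero i)
  refine sub_eq_zero.1 ((mul_eq_zero.1 (MvPolynomial.funext fun v => ?_)).resolve_right hne)
  simp only [map_mul, map_sub, map_prod, MvPolynomial.eval_X, map_zero]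
  by_cases hv : MvPolynomial.eval v (normPoly q N) = 0
  · simp [hv]
  by_cases hv' : ∀ i, v i ≠ 0
  · rw [h v (goodW_of_eval_normPoly_ne_zero hv' hv), sub_self, zero_mul]
  · push Not at hv'
    obtain ⟨i, hi⟩ := hv'
    rw [Finset.prod_eq_zero (Finset.mem_univ i) hi, mul_zero, mul_zero]

/-- The components of the renormalised Bethe vector are Laurent polynomials of bounded degree. -/
theorem exists_betheTilde_eq {q c : ℂ} (hq : q ≠ 0) (hq4 : q^4 ≠ 1) (hc : c^2 = br q * br (q^2))
    {N : ℕ} (σ : Fin N → Fin 3) :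
    ∃ p : MvPolynomial (Fin N) ℂ,
      (∀ w, goodW q w → betheTilde q c w σ = MvPolynomial.eval w p / ∏ k, w k ^ (N - 1)) ∧
      (∀ j, p.degreeOf j ≤ 2 * (N - 1)) ∧
      ∃ κ : ℂ, κ ≠ 0 ∧
        ∀ w, κ * betheHat q c w σ = MvPolynomial.eval w (normPoly q N * p) := by
  obtain ⟨P, hP, hd⟩ := isPolyFun_betheHat q c σ
  beta_reduce at hP hd
  obtain ⟨Q, hQ⟩ := normPoly_dvd hq (P := P) fun w j k hjk hw h => by
    rw [← hP, betheHat_eq_zero hq hq4 hc w hjk hw h, Pi.zero_apply]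
  have hc0 := ne_zero_of_sq_eq hq hq4 hc
  set κ : ℂ := (c ^ N)⁻¹ *
    (-q) ^ (Finset.univ.filter (fun pr : Fin N × Fin N => pr.1 < pr.2)).card with hκ
  have hκ0 : κ ≠ 0 :=
    mul_ne_zero (inv_ne_zero (pow_ne_zero _ hc0)) (pow_ne_zero _ (neg_ne_zero.2 hq))
  refine ⟨MvPolynomial.C κ * Q, fun w hw => ?_, fun j => ?_, κ, hκ0, fun w => ?_⟩
  · have h1 := eval_normPoly_ne_zero hw
    have h2 : ∏ k, w k ^ (N - 1) ≠ 0 :=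
      Finset.prod_ne_zero_iff.2 fun k _ => pow_ne_zero _ (hw.1 k)
    have h3 : ∏ k, w k ^ (2 * (N - 1)) = (∏ k, w k ^ (N - 1)) ^ 2 := by
      simp only [← Finset.prod_pow, ← pow_mul, mul_comm 2]
    rw [betheTilde, bethe_eq_betheHat c hq w hw.1, prod_br hq hw.1, h3, Pi.smul_apply,
      Pi.smul_apply, hP, hQ, map_mul, map_mul, MvPolynomial.eval_C, smul_eq_mul, smul_eq_mul, hκ]
    field_simp
  · refine (MvPolynomial.degreeOf_C_mul_le _ _ _).trans ?_
    by_cases hQ0 : Q = 0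
    · simp [hQ0]
    · have h1 := hd j
      rw [hQ, MvPolynomial.degreeOf_mul_eq (normPoly_ne_zero q N) hQ0, degreeOf_normPoly hq] at h1
      omega
  · rw [hP, hQ, map_mul, map_mul, map_mul, MvPolynomial.eval_C]
    ring

/-- Degree width: each component of `|Ψ̃⟩` is a Laurent polynomial with all exponents of each
`w_j` in `[−(N−1), N−1]` (equivalently `(∏_k w_k^{N−1})·⟨σ|Ψ̃⟩` is a polynomial of degree
≤ 2(N−1) in each variable), and for each `j` the maximal degree width `2(N−1)` in `w_j`
is attained by some component. -/
theorem stmt14 (q c : ℂ) (hq : q ≠ 0) (hq4 : q^4 ≠ 1) (hc : c^2 = br q * br (q^2))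
    (N : ℕ) (hN : 1 ≤ N) :
    (∀ σ : Fin N → Fin 3, ∃! p : MvPolynomial (Fin N) ℂ,
      (∀ w : Fin N → ℂ, goodW q w →
        betheTilde q c w σ = MvPolynomial.eval w p / ∏ k, w k ^ (N-1)) ∧
      ∀ j : Fin N, p.degreeOf j ≤ 2*(N-1)) ∧
    ∀ j : Fin N, ∃ (σ : Fin N → Fin 3) (p : MvPolynomial (Fin N) ℂ),
      (∀ w : Fin N → ℂ, goodW q w →
        betheTilde q c w σ = MvPolynomial.eval w p / ∏ k, w k ^ (N-1)) ∧
      p.degreeOf j = 2*(N-1) ∧ ¬ (MvPolynomial.X j ∣ p) := by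
  refine ⟨fun σ => ?_, fun j => ?_⟩
  · obtain ⟨p, hp, hd, -⟩ := exists_betheTilde_eq hq hq4 hc σ
    refine ⟨p, ⟨hp, hd⟩, fun p' hp' => MvPolynomial.eq_of_forall_goodW (q := q) fun w hw => ?_⟩
    have h2 : ∏ k, w k ^ (N - 1) ≠ 0 :=
      Finset.prod_ne_zero_iff.2 fun k _ => pow_ne_zero _ (hw.1 k)
    exact (div_left_inj' h2).1 ((hp'.1 w hw).symm.trans (hp w hw))
  · obtain ⟨p, hp, hd, κ, hκ, h⟩ := exists_betheTilde_eq hq hq4 hc (1 : Fin N → Fin 3)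
    obtain ⟨v, hv, -, hne⟩ := exists_betheHat_one_ne_zero_of_eq_zero hq hq4 hc j
    have hvp : MvPolynomial.eval v p ≠ 0 := fun h0 => mul_ne_zero hκ hne (by
      rw [h, map_mul, h0, mul_zero])
    refine ⟨1, p, hp, (hd j).antisymm ?_, ?_⟩
    · have hp0 : p ≠ 0 := fun h0 => hvp (by rw [h0, map_zero])
      have h1 := degreeOf_betheHat_one hq hq4 hc
        (P := MvPolynomial.C κ⁻¹ * (normPoly q N * p)) (fun w => by
          rw [map_mul, ← h, MvPolynomial.eval_C, inv_mul_cancel_left₀ hκ]) j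
      have h2 := h1.trans (MvPolynomial.degreeOf_C_mul_le _ _ _)
      rw [MvPolynomial.degreeOf_mul_eq (normPoly_ne_zero q N) hp0, degreeOf_normPoly hq] at h2
      omega
    · rintro ⟨r, rfl⟩
      exact hvp (by rw [map_mul, MvPolynomial.eval_X, hv, zero_mul])

end
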